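/- Let κ > 0, x_c > 0, and y_0, y_c, a, b be real numbers with b > 0 and |a| < κ. Set r_c = sqrt((y_c - y_0)^2 + x_c^2). If the stationarity conditions a + κ·(y_c - y_0)/r_c = 0 and b - κ·x_c^2/r_c^3 = 0 hold, then x_c = κ·(1 - (a/κ)^2)^(3/2)/b and y_c = y_0 - a·(1 - (a/κ)^2)/b. -/

import Mathlib

open Real

theorem airy_caustic_coordinates
    (κ x_c y_0 y_c a b : ℝ)
    (hκ : 0 < κ) (hx : 0 < x_c) (hb : 0 < b) (ha : |a| < κ)
    (r_c : ℝ) (hr : r_c = Real.sqrt ((y_c - y_0)^2 + x_c^2))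
    (h1 : a + κ * (y_c - y_0) / r_c = 0)
    (h2 : b - κ * x_c^2 / r_c^3 = 0) :
    x_c = κ * (1 - (a / κ)^2) ^ ((3 : ℝ) / 2) / b ∧
    y_c = y_0 - a * (1 - (a / κ)^2) / b := by
  have hpos : 0 < (y_c - y_0)^2 + x_c^2 := by positivity
  have hr0 : 0 < r_c := hr ▸ Real.sqrt_pos.mpr hpos
  have hrsq : r_c^2 = (y_c - y_0)^2 + x_c^2 := by rw [hr, Real.sq_sqrt hpos.le]
  have ha_eq : a = -(κ * (y_c - y_0) / r_c) := by linarith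
  have hb_eq : b = κ * x_c^2 / r_c^3 := by linarith
  have hcos : 1 - (a / κ)^2 = (x_c / r_c)^2 := by
    rw [ha_eq]
    field_simp
    linarith
  have hpow : ((x_c / r_c)^2) ^ ((3 : ℝ) / 2) = (x_c / r_c)^3 := by
    rw [← Real.rpow_natCast_mul (by positivity), ← Real.rpow_natCast]
    norm_num
  rw [hcos, hpow, ha_eq, hb_eq]
  constructor
  · field_simp
  · field_simp
    ring
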